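/- arXiv:2008.09781 — 12 statements merged into one kernel-verified Lean document; each statement's English description precedes it below -/
import Mathlib

section
/- Let Ω ⊆ ℝⁿ be a nonempty closed convex set, x̄ ∈ Ω and g ∈ ℝⁿ. Then max(0, sup_{h ∈ Ω, h ≠ x̄} ⟨g, (h − x̄)/‖h − x̄‖⟩) = dist(g, N_Ω(x̄)) = ‖π(T_Ω(x̄), g)‖, where π(T_Ω(x̄), ·) denotes the metric projection onto the closed convex cone T_Ω(x̄) (the supremum over the empty set, when Ω = {x̄}, is taken as 0). -/
open scoped RealInnerProductSpace

/-- The normal cone to a convex set `Ω` at a point `x`. -/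
def normalCone {E : Type*} [NormedAddCommGroup E] [InnerProductSpace ℝ E]
    (Ω : Set E) (x : E) : Set E :=
  {v | ∀ y ∈ Ω, ⟪v, y - x⟫ ≤ 0}

/-- The tangent cone to a convex set `Ω` at a point `x`. -/
def tangentConeConvex {E : Type*} [NormedAddCommGroup E] [InnerProductSpace ℝ E]
    (Ω : Set E) (x : E) : Set E :=
  closure {w | ∃ l : ℝ, 0 < l ∧ x + l • w ∈ Ω}

section ConvexCones

variable {E : Type*} [NormedAddCommGroup E] [InnerProductSpace ℝ E] {Ω : Set E} {x : E}

theorem sub_mem_tangentConeConvex {y : E} (hy : y ∈ Ω) : y - x ∈ tangentConeConvex Ω x :=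
  subset_closure ⟨1, one_pos, by simpa using hy⟩

theorem zero_mem_tangentConeConvex (hx : x ∈ Ω) : (0 : E) ∈ tangentConeConvex Ω x := by
  simpa using sub_mem_tangentConeConvex (x := x) hx

theorem smul_mem_tangentConeConvex {w : E} (hw : w ∈ tangentConeConvex Ω x) {c : ℝ}
    (hc : 0 < c) : c • w ∈ tangentConeConvex Ω x := by
  refine map_mem_closure (continuous_const_smul c) hw ?_
  rintro w ⟨l, hl, h⟩
  refine ⟨l / c, div_pos hl hc, ?_⟩
  rwa [smul_smul, div_mul_cancel₀ _ hc.ne']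

theorem convex_tangentConeConvex (hconv : Convex ℝ Ω) (hx : x ∈ Ω) :
    Convex ℝ (tangentConeConvex Ω x) := by
  have shrink {w : E} {l m : ℝ} (hm : 0 < m) (hml : m ≤ l) (h : x + l • w ∈ Ω) :
      x + m • w ∈ Ω := by
    have hl := hm.trans_le hml
    have := hconv.add_smul_mem hx h ⟨(div_pos hm hl).le, (div_le_one hl).2 hml⟩
    rwa [smul_smul, div_mul_cancel₀ _ hl.ne'] at this
  refine Convex.closure ?_
  rintro v ⟨l, hl, hv⟩ w ⟨m, hm, hw⟩ a b ha hb hab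
  have hpos := lt_min hl hm
  refine ⟨min l m, hpos, ?_⟩
  have := hconv (shrink hpos (min_le_left l m) hv) (shrink hpos (min_le_right l m) hw) ha hb hab
  convert this using 1
  obtain rfl : b = 1 - a := by linarith
  module

/-- A homogeneous upper bound for a linear functional on `Ω - x` extends to the tangent cone. -/
theorem inner_le_mul_norm_of_mem_tangentConeConvex {v : E} {c : ℝ}
    (h : ∀ y ∈ Ω, ⟪v, y - x⟫ ≤ c * ‖y - x‖) {w : E} (hw : w ∈ tangentConeConvex Ω x) :
    ⟪v, w⟫ ≤ c * ‖w‖ := by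
  refine closure_minimal (t := {w : E | ⟪v, w⟫ ≤ c * ‖w‖}) ?_
    (isClosed_le (by fun_prop) (by fun_prop)) hw
  rintro w ⟨l, hl, hy⟩
  have := h _ hy
  rw [add_sub_cancel_left, inner_smul_right, norm_smul, Real.norm_of_nonneg hl.le,
    mul_left_comm] at this
  exact le_of_mul_le_mul_left this hl

theorem inner_nonpos_of_mem_normalCone {v w : E} (hv : v ∈ normalCone Ω x)
    (hw : w ∈ tangentConeConvex Ω x) : ⟪v, w⟫ ≤ 0 := by
  simpa using inner_le_mul_norm_of_mem_tangentConeConvex (c := 0) (fun y hy => by simpa using hv y hy) hw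

/-- Moreau decomposition: subtracting the projection onto the tangent cone leaves an element of
the normal cone orthogonal to the projection. -/
theorem sub_mem_normalCone_and_inner_eq_zero (hconv : Convex ℝ Ω) (hx : x ∈ Ω) {g p : E}
    (hp : p ∈ tangentConeConvex Ω x)
    (hmin : ∀ q ∈ tangentConeConvex Ω x, ‖g - p‖ ≤ ‖g - q‖) :
    g - p ∈ normalCone Ω x ∧ ⟪g - p, p⟫ = 0 := by
  have hvar : ∀ q ∈ tangentConeConvex Ω x, ⟪g - p, q - p⟫ ≤ 0 := by
    refine (norm_eq_iInf_iff_real_inner_le_zero (convex_tangentConeConvex hconv hx) hp).1 ?_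
    have : Nonempty (tangentConeConvex Ω x) := ⟨⟨p, hp⟩⟩
    refine le_antisymm (le_ciInf fun q => hmin q q.2) ?_
    exact ciInf_le (f := fun q : tangentConeConvex Ω x => ‖g - q‖)
      ⟨0, by rintro _ ⟨q, rfl⟩; exact norm_nonneg _⟩ ⟨p, hp⟩
  have horth : ⟪g - p, p⟫ = 0 := by
    have h₀ := hvar 0 (zero_mem_tangentConeConvex hx)
    have h₂ := hvar _ (smul_mem_tangentConeConvex hp two_pos)
    rw [zero_sub, inner_neg_right] at h₀
    rw [two_smul, add_sub_cancel_right] at h₂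
    linarith
  refine ⟨fun y hy => ?_, horth⟩
  have := hvar _ (sub_mem_tangentConeConvex hy)
  rwa [inner_sub_right _ (y - x), horth, sub_zero] at this

theorem infDist_normalCone_eq_norm (hconv : Convex ℝ Ω) (hx : x ∈ Ω) {g p : E}
    (hp : p ∈ tangentConeConvex Ω x)
    (hmin : ∀ q ∈ tangentConeConvex Ω x, ‖g - p‖ ≤ ‖g - q‖) :
    Metric.infDist g (normalCone Ω x) = ‖p‖ := by
  obtain ⟨hmem, horth⟩ := sub_mem_normalCone_and_inner_eq_zero hconv hx hp hmin
  refine le_antisymm ((Metric.infDist_le_dist_of_mem hmem).trans_eq (by simp)) ?_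
  refine (Metric.le_infDist ⟨_, hmem⟩).2 fun v hv => ?_
  rw [dist_eq_norm]
  have hvp := inner_nonpos_of_mem_normalCone hv hp
  have hcs := real_inner_le_norm (g - v) p
  rw [inner_sub_left, real_inner_self_eq_norm_sq] at horth
  rw [inner_sub_left] at hcs
  by_contra! hlt
  nlinarith [norm_nonneg (g - v)]

theorem max_sSup_slope_eq_norm (hconv : Convex ℝ Ω) (hx : x ∈ Ω) {g p : E}
    (hp : p ∈ tangentConeConvex Ω x)
    (hmin : ∀ q ∈ tangentConeConvex Ω x, ‖g - p‖ ≤ ‖g - q‖) :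
    max 0 (sSup {r : ℝ | ∃ h ∈ Ω, h ≠ x ∧ r = ⟪g, ‖h - x‖⁻¹ • (h - x)⟫}) = ‖p‖ := by
  obtain ⟨hmem, horth⟩ := sub_mem_normalCone_and_inner_eq_zero hconv hx hp hmin
  set S := {r : ℝ | ∃ h ∈ Ω, h ≠ x ∧ r = ⟪g, ‖h - x‖⁻¹ • (h - x)⟫}
  have hbound : ∀ r ∈ S, r ≤ ‖p‖ := by
    rintro _ ⟨h, hh, hne, rfl⟩
    rw [inner_smul_right, inv_mul_le_iff₀ (norm_sub_pos_iff.2 hne)]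
    have h₁ := hmem h hh
    rw [inner_sub_left] at h₁
    linarith [real_inner_le_norm p (h - x)]
  refine le_antisymm (max_le (norm_nonneg p) (Real.sSup_le hbound (norm_nonneg p))) ?_
  have hslope : ⟪g, p⟫ ≤ max 0 (sSup S) * ‖p‖ := by
    refine inner_le_mul_norm_of_mem_tangentConeConvex (fun y hy => ?_) hp
    rcases eq_or_ne y x with rfl | hne
    · simp
    · have hle := le_csSup ⟨‖p‖, hbound⟩ (show _ ∈ S from ⟨y, hy, hne, rfl⟩)
      rw [inner_smul_right, inv_mul_le_iff₀ (norm_sub_pos_iff.2 hne), mul_comm] at hle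
      exact hle.trans (by gcongr; exact le_max_right _ _)
  rw [inner_sub_left, real_inner_self_eq_norm_sq] at horth
  by_contra! hlt
  nlinarith [le_max_left 0 (sSup S)]

end ConvexCones

/-- for a nonempty closed convex set `Ω ⊆ ℝⁿ`, `x̄ ∈ Ω` and `g ∈ ℝⁿ`,
`max(0, sup_{h ∈ Ω, h ≠ x̄} ⟨g, (h − x̄)/‖h − x̄‖⟩) = dist(g, N_Ω(x̄)) = ‖π(T_Ω(x̄), g)‖`. -/
theorem max_sup_slope_eq_dist_normalCone_eq_norm_proj_tangentCone
    {n : ℕ} (Ω : Set (EuclideanSpace ℝ (Fin n)))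
    (hne : Ω.Nonempty) (hcl : IsClosed Ω) (hconv : Convex ℝ Ω)
    (xb : EuclideanSpace ℝ (Fin n)) (hxb : xb ∈ Ω) (g : EuclideanSpace ℝ (Fin n)) :
    max 0 (sSup {r : ℝ | ∃ h ∈ Ω, h ≠ xb ∧ r = ⟪g, ‖h - xb‖⁻¹ • (h - xb)⟫})
        = Metric.infDist g (normalCone Ω xb) ∧
    ∀ p ∈ tangentConeConvex Ω xb,
      (∀ q ∈ tangentConeConvex Ω xb, ‖g - p‖ ≤ ‖g - q‖) →
      Metric.infDist g (normalCone Ω xb) = ‖p‖ := by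
  obtain ⟨p, hp, hdist⟩ := IsClosed.exists_infDist_eq_dist
    (isClosed_closure : IsClosed (tangentConeConvex Ω xb)) ⟨0, zero_mem_tangentConeConvex hxb⟩ g
  have hmin : ∀ q ∈ tangentConeConvex Ω xb, ‖g - p‖ ≤ ‖g - q‖ := fun q hq => by
    rw [← dist_eq_norm, ← dist_eq_norm, ← hdist]
    exact Metric.infDist_le_dist_of_mem hq
  refine ⟨?_, fun q hq hqmin => infDist_normalCone_eq_norm hconv hxb hq hqmin⟩
  rw [max_sSup_slope_eq_norm hconv hxb hp hmin, infDist_normalCone_eq_norm hconv hxb hp hmin]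
end

section
/- Let C ⊆ ℝⁿ be a closed convex cone containing 0, and let C* = {v ∈ ℝⁿ : ⟨v, c⟩ ≤ 0 for all c ∈ C} be its polar cone. Then for every y ∈ ℝⁿ, dist(y, C*) = sup_{c ∈ C} ⟨ĉ, y⟩, where ĉ = c/‖c‖ for c ≠ 0 and 0̂ = 0. -/
open scoped RealInnerProductSpace Classical

/-- The metric projection of `y` onto a closed convex cone, with its variational
characterization: the residual is orthogonal to the projection and lies in the polar cone. -/
theorem exists_cone_projection {E : Type*} [NormedAddCommGroup E] [InnerProductSpace ℝ E]
    [CompleteSpace E] {C : Set E} (hcl : IsClosed C) (hconv : Convex ℝ C) (h0 : (0 : E) ∈ C)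
    (hcone : ∀ c ∈ C, ∀ r : ℝ, 0 ≤ r → r • c ∈ C) (y : E) :
    ∃ p ∈ C, ⟪y - p, p⟫ = 0 ∧ ∀ c ∈ C, ⟪y - p, c⟫ ≤ 0 := by
  obtain ⟨p, hp, hmin⟩ :=
    exists_norm_eq_iInf_of_complete_convex ⟨0, h0⟩ hcl.isComplete hconv y
  have hvar := (norm_eq_iInf_iff_real_inner_le_zero hconv hp).1 hmin
  have horth : ⟪y - p, p⟫ = 0 := by
    have h₁ := hvar 0 h0
    have h₂ := hvar ((2 : ℝ) • p) (hcone p hp 2 (by norm_num))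
    rw [inner_sub_right, inner_zero_right] at h₁
    rw [inner_sub_right, inner_smul_right] at h₂
    linarith
  refine ⟨p, hp, horth, fun c hc => ?_⟩
  have h := hvar c hc
  rwa [inner_sub_right, horth, sub_zero] at h

/-- The inner product of `y` with a normalized vector of a set is at most the distance from `y`
to any vector making nonpositive inner products with that set. -/
theorem inner_normalized_le_dist {E : Type*} [NormedAddCommGroup E] [InnerProductSpace ℝ E]
    [DecidableEq E] {c v : E} (hv : ⟪v, c⟫ ≤ 0) (y : E) :
    ⟪(if c = 0 then 0 else ‖c‖⁻¹ • c : E), y⟫ ≤ dist y v := by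
  split_ifs with hc
  · simp
  · have hc' : 0 < ‖c‖ := norm_pos_iff.2 hc
    rw [real_inner_smul_left, inv_mul_le_iff₀ hc', dist_eq_norm]
    have h := real_inner_le_norm c (y - v)
    rw [inner_sub_right, real_inner_comm v c] at h
    linarith

/-- for a closed convex cone `C ⊆ ℝⁿ` containing `0` with polar cone
`C* = {v : ⟨v,c⟩ ≤ 0 ∀ c ∈ C}`, for every `y`, `dist(y, C*) = sup_{c ∈ C} ⟨ĉ, y⟩`,
where `ĉ = c/‖c‖` for `c ≠ 0` and `0̂ = 0`. -/
theorem dist_polar_eq_sup_inner_normalized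
    {n : ℕ} (C : Set (EuclideanSpace ℝ (Fin n)))
    (hcl : IsClosed C) (hconv : Convex ℝ C)
    (h0 : (0 : EuclideanSpace ℝ (Fin n)) ∈ C)
    (hcone : ∀ c ∈ C, ∀ r : ℝ, 0 ≤ r → r • c ∈ C)
    (y : EuclideanSpace ℝ (Fin n)) :
    Metric.infDist y {v : EuclideanSpace ℝ (Fin n) | ∀ c ∈ C, ⟪v, c⟫ ≤ 0}
      = sSup {r : ℝ | ∃ c ∈ C,
          r = ⟪(if c = 0 then 0 else ‖c‖⁻¹ • c : EuclideanSpace ℝ (Fin n)), y⟫} := by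
  obtain ⟨p, hp, horth, hpolar⟩ := exists_cone_projection hcl hconv h0 hcone y
  set P : Set (EuclideanSpace ℝ (Fin n)) := {v | ∀ c ∈ C, ⟪v, c⟫ ≤ 0}
  have hmem : y - p ∈ P := hpolar
  have hle : Metric.infDist y P ≤ ‖p‖ := by
    simpa [dist_eq_norm] using Metric.infDist_le_dist_of_mem (x := y) hmem
  have hattained : ⟪(if p = 0 then 0 else ‖p‖⁻¹ • p : EuclideanSpace ℝ (Fin n)), y⟫ = ‖p‖ := by
    split_ifs with hp0
    · simp [hp0]
    · have hne : ‖p‖ ≠ 0 := norm_ne_zero_iff.2 hp0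
      have hpy : ⟪p, y⟫ = ‖p‖ * ‖p‖ := by
        rw [inner_sub_left, real_inner_self_eq_norm_mul_norm, real_inner_comm] at horth
        linarith
      rw [real_inner_smul_left, hpy, inv_mul_cancel_left₀ hne]
  have hupper : ∀ c ∈ C,
      ⟪(if c = 0 then 0 else ‖c‖⁻¹ • c : EuclideanSpace ℝ (Fin n)), y⟫ ≤ Metric.infDist y P :=
    fun c hc => (Metric.le_infDist ⟨_, hmem⟩).2 fun _ hv => inner_normalized_le_dist (hv c hc) y
  symm
  apply IsGreatest.csSup_eq
  constructor
  · exact ⟨p, hp, le_antisymm (hle.trans_eq hattained.symm) (hupper p hp)⟩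
  · rintro _ ⟨c, hc, rfl⟩
    exact hupper c hc
end

section
/- Let Ω ⊆ ℝⁿ be a closed convex set and x̄ ∈ Ω. Then the closure of the set {(h − x̄)/‖h − x̄‖ : h ∈ Ω, h ≠ x̄} equals the set {w/‖w‖ : w ∈ T_Ω(x̄), w ≠ 0} of unit vectors of the tangent cone. -/
open scoped RealInnerProductSpace

section NormalizedDirections

variable {E : Type*} [NormedAddCommGroup E] [InnerProductSpace ℝ E]

/-- The closure of the normalized directions lies in the tangent cone and in the unit sphere. -/
theorem closure_normalized_directions_subset (Ω : Set E) (x : E) :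
    closure {u : E | ∃ h ∈ Ω, h ≠ x ∧ u = ‖h - x‖⁻¹ • (h - x)}
      ⊆ tangentConeConvex Ω x ∩ Metric.sphere 0 1 := by
  refine (closure_mono ?_).trans (closure_inter_subset_inter_closure
    {w | ∃ l : ℝ, 0 < l ∧ x + l • w ∈ Ω} (Metric.sphere 0 1)) |>.trans ?_
  · rintro _ ⟨h, hh, hne, rfl⟩
    have hpos : 0 < ‖h - x‖ := norm_pos_iff.2 (sub_ne_zero.2 hne)
    refine ⟨⟨‖h - x‖, hpos, ?_⟩, ?_⟩
    · rwa [smul_inv_smul₀ hpos.ne', add_sub_cancel]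
    · rw [mem_sphere_zero_iff_norm, norm_smul, norm_inv, norm_norm, inv_mul_cancel₀ hpos.ne']
  · rw [Metric.isClosed_sphere.closure_eq]
    exact subset_rfl

/-- Normalizing a nonzero tangent vector gives a limit of normalized directions. -/
theorem normalize_mem_closure_normalized_directions {Ω : Set E} {x w : E}
    (hw : w ∈ tangentConeConvex Ω x) (hw0 : w ≠ 0) :
    ‖w‖⁻¹ • w ∈ closure {u : E | ∃ h ∈ Ω, h ≠ x ∧ u = ‖h - x‖⁻¹ • (h - x)} := by
  have hcont : ContinuousAt (fun v : E => ‖v‖⁻¹ • v) w :=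
    (continuousAt_id.norm.inv₀ (norm_ne_zero_iff.2 hw0)).smul continuousAt_id
  have hmem : w ∈ closure ({0}ᶜ ∩ {v | ∃ l : ℝ, 0 < l ∧ x + l • v ∈ Ω}) :=
    isOpen_compl_singleton.inter_closure ⟨hw0, hw⟩
  refine hcont.continuousWithinAt.mem_closure hmem ?_
  rintro v ⟨hv0, l, hl, hv⟩
  refine ⟨x + l • v, hv, ?_, ?_⟩
  · simpa [hl.ne'] using hv0
  · rw [add_sub_cancel_left, norm_smul, Real.norm_of_nonneg hl.le, smul_smul, mul_inv,
      mul_right_comm, inv_mul_cancel₀ hl.ne', one_mul]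

end NormalizedDirections

/-- for a closed convex set `Ω ⊆ ℝⁿ` and `x̄ ∈ Ω`, the closure of the set of
normalized directions `(h − x̄)/‖h − x̄‖` for `h ∈ Ω`, `h ≠ x̄`, equals the set of unit vectors
`w/‖w‖` of nonzero elements `w` of the tangent cone `T_Ω(x̄)`. -/
theorem closure_normalized_directions_eq_unit_tangentCone
    {n : ℕ} (Ω : Set (EuclideanSpace ℝ (Fin n)))
    (hcl : IsClosed Ω) (hconv : Convex ℝ Ω)
    (xb : EuclideanSpace ℝ (Fin n)) (hxb : xb ∈ Ω) :
    closure {u : EuclideanSpace ℝ (Fin n) | ∃ h ∈ Ω, h ≠ xb ∧ u = ‖h - xb‖⁻¹ • (h - xb)}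
      = {u : EuclideanSpace ℝ (Fin n) |
          ∃ w ∈ tangentConeConvex Ω xb, w ≠ 0 ∧ u = ‖w‖⁻¹ • w} := by
  apply Set.Subset.antisymm
  · intro u hu
    obtain ⟨hu, hu1⟩ := closure_normalized_directions_subset Ω xb hu
    rw [mem_sphere_zero_iff_norm] at hu1
    exact ⟨u, hu, norm_ne_zero_iff.1 (by simp [hu1]), by simp [hu1]⟩
  · rintro _ ⟨w, hw, hw0, rfl⟩
    exact normalize_mem_closure_normalized_directions hw hw0
end

section
/- Let f : ℝⁿ → ℝ be differentiable with L-Lipschitz gradient (L > 0), let x̄ ∈ ℝⁿ, g = −∇f(x̄), and let d ∈ ℝⁿ \ {0} and y ∈ ℝⁿ. (i) If for some β ≥ 0 the point y + βd lies in the closed ball of center x̄ and radius ⟨g, d/‖d‖⟩/L, then ⟨∇f(y + βd), d⟩ ≤ 0. (ii) If both y and y + β₁d lie in this closed ball for some β₁ ≥ 0, then f(y + β₁d) ≤ f(y). -/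
open scoped RealInnerProductSpace

/-- A vector field that is `L`-Lipschitz has non-positive inner product with `d` on the closed
ball around `c` of radius `⟪-F c, d / ‖d‖⟫ / L`. -/
theorem inner_nonpos_of_mem_closedBall {E : Type*} [NormedAddCommGroup E] [InnerProductSpace ℝ E]
    {F : E → E} {L : ℝ} (hL : 0 < L) (hlip : ∀ x y, ‖F x - F y‖ ≤ L * ‖x - y‖)
    {c d z : E} (hd : d ≠ 0) (hz : z ∈ Metric.closedBall c (⟪-F c, ‖d‖⁻¹ • d⟫ / L)) :
    ⟪F z, d⟫ ≤ 0 := by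
  have hd' : 0 < ‖d‖ := norm_pos_iff.mpr hd
  rw [mem_closedBall_iff_norm, le_div_iff₀ hL, real_inner_smul_right, inner_neg_left,
    inv_mul_eq_div, le_div_iff₀ hd'] at hz
  have hcs := real_inner_le_norm (F z - F c) d
  rw [inner_sub_left] at hcs
  have hmul := mul_le_mul_of_nonneg_right (hlip z c) hd'.le
  linarith

/-- let `f : ℝⁿ → ℝ` be differentiable with `L`-Lipschitz gradient, `x̄ ∈ ℝⁿ`,
`g = −∇f(x̄)`, `d ≠ 0`, `y ∈ ℝⁿ`.
(i) If `y + βd` lies in the closed ball of center `x̄` and radius `⟨g, d/‖d‖⟩/L` for some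
`β ≥ 0`, then `⟨∇f(y + βd), d⟩ ≤ 0`.
(ii) If both `y` and `y + β₁d` lie in this ball for some `β₁ ≥ 0`, then `f(y + β₁d) ≤ f(y)`. -/
theorem monotone_along_direction_in_ball
    {n : ℕ} (f : EuclideanSpace ℝ (Fin n) → ℝ)
    (f' : EuclideanSpace ℝ (Fin n) → EuclideanSpace ℝ (Fin n))
    (hgrad : ∀ x, HasGradientAt f (f' x) x)
    (L : ℝ) (hL : 0 < L)
    (hlip : ∀ x y, ‖f' x - f' y‖ ≤ L * ‖x - y‖)
    (xb g d y : EuclideanSpace ℝ (Fin n)) (hg : g = -f' xb) (hd : d ≠ 0) :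
    (∀ β : ℝ, 0 ≤ β →
      y + β • d ∈ Metric.closedBall xb (⟪g, ‖d‖⁻¹ • d⟫ / L) →
      ⟪f' (y + β • d), d⟫ ≤ 0) ∧
    (∀ β₁ : ℝ, 0 ≤ β₁ →
      y ∈ Metric.closedBall xb (⟪g, ‖d‖⁻¹ • d⟫ / L) →
      y + β₁ • d ∈ Metric.closedBall xb (⟪g, ‖d‖⁻¹ • d⟫ / L) →
      f (y + β₁ • d) ≤ f y) := by
  subst hg
  refine ⟨fun β _ hβ => inner_nonpos_of_mem_closedBall hL hlip hd hβ, fun β₁ hβ₁ hy hyβ => ?_⟩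
  have hderiv (t : ℝ) : HasDerivAt (fun t : ℝ => f (y + t • d)) ⟪f' (y + t • d), d⟫ t := by
    have hline : HasDerivAt (fun t : ℝ => y + t • d) d t := by
      simpa using ((hasDerivAt_id t).smul_const d).const_add y
    exact (hgrad (y + t • d)).hasFDerivAt.comp_hasDerivAt t hline
  have hanti : AntitoneOn (fun t : ℝ => f (y + t • d)) (Set.Icc 0 β₁) := by
    refine antitoneOn_of_deriv_nonpos (convex_Icc 0 β₁)
      (fun t _ => (hderiv t).continuousAt.continuousWithinAt)
      (fun t _ => (hderiv t).differentiableAt.differentiableWithinAt) fun t ht => ?_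
    rw [(hderiv t).deriv]
    refine inner_nonpos_of_mem_closedBall (c := xb) hL hlip hd ?_
    rw [interior_Icc] at ht
    have hmem := (convex_closedBall xb _).add_smul_mem hy hyβ
      (t := t / β₁) ⟨div_nonneg ht.1.le hβ₁, div_le_one_of_le₀ ht.2.le hβ₁⟩
    rwa [smul_smul, div_mul_cancel₀ _ (ht.1.trans ht.2).ne'] at hmem
  simpa using hanti (Set.left_mem_Icc.mpr hβ₁) (Set.right_mem_Icc.mpr hβ₁) hβ₁
end

section
/- Let g ∈ ℝⁿ, L > 0, x ∈ ℝⁿ, T ≥ 1 an integer, and let y₀ = x, y₁, …, y_T ∈ ℝⁿ with y_{j+1} = y_j + α_j d_j for some α_j ≥ 0 and d_j ∈ ℝⁿ \ {0} with ⟨g, d_j⟩ ≥ 0 for 0 ≤ j ≤ T−1. Assume L‖y_j − x‖² ≤ ⟨g, y_j − x⟩ for all 0 ≤ j ≤ T, that L‖y_T − x‖² = ⟨g, y_T − x⟩, and y_T ≠ x. Then: (i) ‖y_T − x‖ ≥ ‖y_j − x‖ for every 0 ≤ j ≤ T; (ii) min_{0 ≤ j ≤ T−1} ⟨g, d_j/‖d_j‖⟩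 ≤ ⟨g, y_T − x⟩/‖y_T − x‖ = L‖y_T − x‖. -/
open scoped RealInnerProductSpace

/-- Along steps with `⟪g, d j⟫ ≥ 0` and nonnegative stepsizes, `⟪g, y j⟫` is nondecreasing. -/
theorem inner_le_inner_of_steps {E : Type*} [NormedAddCommGroup E] [InnerProductSpace ℝ E]
    {g : E} {T : ℕ} {y d : ℕ → E} {α : ℕ → ℝ}
    (hstep : ∀ j < T, y (j + 1) = y j + α j • d j) (hα : ∀ j < T, 0 ≤ α j)
    (hgd : ∀ j < T, 0 ≤ ⟪g, d j⟫) {j k : ℕ} (hjk : j ≤ k) (hk : k ≤ T) :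
    ⟪g, y j⟫ ≤ ⟪g, y k⟫ := by
  induction k, hjk using Nat.le_induction with
  | base => exact le_rfl
  | succ k _ ih =>
    rw [hstep k hk, inner_add_right, inner_smul_right]
    linarith [ih (Nat.le_of_succ_le hk), mul_nonneg (hα k hk) (hgd k hk)]

/-- If every direction makes `⟪g, d j⟫ > m ‖d j‖`, so does every nonzero total displacement. -/
theorem eq_or_mul_norm_lt_inner_of_steps {E : Type*} [NormedAddCommGroup E]
    [InnerProductSpace ℝ E] {g : E} {m : ℝ} (hm : 0 ≤ m) {T : ℕ} {y d : ℕ → E} {α : ℕ → ℝ}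
    (hstep : ∀ j < T, y (j + 1) = y j + α j • d j) (hα : ∀ j < T, 0 ≤ α j)
    (hgd : ∀ j < T, m * ‖d j‖ < ⟪g, d j⟫) {k : ℕ} (hk : k ≤ T) :
    y k = y 0 ∨ m * ‖y k - y 0‖ < ⟪g, y k - y 0⟫ := by
  induction k with
  | zero => exact Or.inl rfl
  | succ k ih =>
    have ih := ih (Nat.le_of_succ_le hk)
    rcases (hα k hk).eq_or_lt with h0 | hpos
    · simpa [hstep k hk, ← h0] using ih
    · have hle : m * ‖y k - y 0‖ ≤ ⟪g, y k - y 0⟫ := by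
        rcases ih with h | h
        · simp [h]
        · exact h.le
      right
      rw [hstep k hk, add_sub_right_comm, inner_add_right, inner_smul_right]
      calc m * ‖y k - y 0 + α k • d k‖
          ≤ m * (‖y k - y 0‖ + α k * ‖d k‖) := by
            gcongr
            simpa [norm_smul, abs_of_pos hpos] using norm_add_le (y k - y 0) (α k • d k)
        _ = m * ‖y k - y 0‖ + α k * (m * ‖d k‖) := by ring
        _ < ⟪g, y k - y 0⟫ + α k * ⟪g, d k⟫ :=
            add_lt_add_of_le_of_lt hle (mul_lt_mul_of_pos_left (hgd k hk) hpos)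

/-- Case 4 of Proposition 4.2: for a sequence `y₀ = x, y₁, …, y_T` built with
nonnegative stepsizes along descent directions `d_j` with `⟨g, d_j⟩ ≥ 0`, staying in the region
`L‖y − x‖² ≤ ⟨g, y − x⟩`, and with `y_T` on the boundary `L‖y_T − x‖² = ⟨g, y_T − x⟩`, `y_T ≠ x`:
(i) `‖y_T − x‖ ≥ ‖y_j − x‖` for all `j ≤ T`;
(ii) `min_{j < T} ⟨g, d_j/‖d_j‖⟩ ≤ ⟨g, y_T − x⟩/‖y_T − x‖ = L‖y_T − x‖`. -/
theorem boundary_exit_case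
    {n : ℕ} (g x : EuclideanSpace ℝ (Fin n)) (L : ℝ) (hL : 0 < L)
    (T : ℕ) (hT : 1 ≤ T)
    (y d : ℕ → EuclideanSpace ℝ (Fin n)) (α : ℕ → ℝ)
    (hy0 : y 0 = x)
    (hstep : ∀ j < T, y (j + 1) = y j + α j • d j)
    (hα : ∀ j < T, 0 ≤ α j)
    (hdne : ∀ j < T, d j ≠ 0)
    (hgd : ∀ j < T, 0 ≤ ⟪g, d j⟫)
    (hin : ∀ j ≤ T, L * ‖y j - x‖ ^ 2 ≤ ⟪g, y j - x⟫)
    (hbd : L * ‖y T - x‖ ^ 2 = ⟪g, y T - x⟫)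
    (hne : y T ≠ x) :
    (∀ j ≤ T, ‖y j - x‖ ≤ ‖y T - x‖) ∧
    (∃ j < T, ⟪g, ‖d j‖⁻¹ • d j⟫ ≤ ⟪g, y T - x⟫ / ‖y T - x‖) ∧
    ⟪g, y T - x⟫ / ‖y T - x‖ = L * ‖y T - x‖ := by
  have hpos : 0 < ‖y T - x‖ := norm_pos_iff.mpr (sub_ne_zero.mpr hne)
  have hratio : ⟪g, y T - x⟫ / ‖y T - x‖ = L * ‖y T - x‖ := by
    rw [← hbd]
    field_simp
  refine ⟨fun j hj => ?_, ?_, hratio⟩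
  · have hmono : ⟪g, y j - x⟫ ≤ ⟪g, y T - x⟫ := by
      simpa only [inner_sub_right, sub_le_sub_iff_right] using
        inner_le_inner_of_steps hstep hα hgd hj le_rfl
    have hsq : L * ‖y j - x‖ ^ 2 ≤ L * ‖y T - x‖ ^ 2 := by linarith [hin j hj]
    exact (sq_le_sq₀ (norm_nonneg _) hpos.le).mp (le_of_mul_le_mul_left hsq hL)
  · rw [hratio]
    by_contra! hlt
    have hdir : ∀ j < T, L * ‖y T - x‖ * ‖d j‖ < ⟪g, d j⟫ := by
      intro j hj
      have h := hlt j hj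
      rwa [inner_smul_right, ← div_eq_inv_mul,
        lt_div_iff₀ (norm_pos_iff.mpr (hdne j hj))] at h
    have h := eq_or_mul_norm_lt_inner_of_steps (mul_pos hL hpos).le hstep hα hdir le_rfl
    rw [hy0] at h
    have hlt' := h.resolve_left hne
    rw [← hbd] at hlt'
    nlinarith
end

section
/- Let η > 0 and let α : [0,η) → (0,∞] be continuous, nonincreasing and finite on (0,η), and suppose I = ∫₀^η α(t) dt < +∞. Then for every f₀ ∈ [0,η): Σ_{s=0}^∞ √(σ_α^{(s)}(f₀) − σ_α^{(s+1)}(f₀)) ≤ I + 2√(f₀ − σ_α(f₀)). -/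
open scoped ENNReal
open MeasureTheory

/-- The worst-case one-dimensional map `σ_α(t) = max{ s ∈ [0,t] : 1/α(s)² ≤ t − s }`
(maximum of the empty set taken as `0`; the convention `1/∞ = 0` is built into `ℝ≥0∞`). -/
noncomputable def sigmaAlpha (α : ℝ → ℝ≥0∞) (t : ℝ) : ℝ :=
  sSup {s : ℝ | s ∈ Set.Icc 0 t ∧ (α s)⁻¹ ^ 2 ≤ ENNReal.ofReal (t - s)}

theorem sigmaAlpha_mem_Icc (α : ℝ → ℝ≥0∞) {t : ℝ} (ht : 0 ≤ t) :
    sigmaAlpha α t ∈ Set.Icc 0 t :=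
  ⟨Real.sSup_nonneg fun _ hs => hs.1.1, Real.sSup_le (fun _ hs => hs.1.2) ht⟩

/-- A positive value of `sigmaAlpha` is attained. -/
theorem inv_sq_sigmaAlpha_le {α : ℝ → ℝ≥0∞} {t : ℝ} (hcont : ContinuousOn α (Set.Icc 0 t))
    (hpos : 0 < sigmaAlpha α t) :
    (α (sigmaAlpha α t))⁻¹ ^ 2 ≤ ENNReal.ofReal (t - sigmaAlpha α t) := by
  have hne : {s : ℝ | s ∈ Set.Icc 0 t ∧ (α s)⁻¹ ^ 2 ≤ ENNReal.ofReal (t - s)}.Nonempty := by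
    by_contra h
    rw [Set.not_nonempty_iff_eq_empty] at h
    rw [sigmaAlpha, h, Real.sSup_empty] at hpos
    exact hpos.false
  have hclosed : IsClosed {s : ℝ | s ∈ Set.Icc 0 t ∧
      (α s)⁻¹ ^ 2 ≤ ENNReal.ofReal (t - s)} := by
    refine isClosed_Icc.isClosed_le ?_ ?_
    · exact (ENNReal.continuous_pow 2).comp_continuousOn
        (continuous_inv.comp_continuousOn hcont)
    · exact (ENNReal.continuous_ofReal.comp (continuous_const.sub continuous_id)).continuousOn
  exact (hclosed.csSup_mem hne ⟨t, fun _ hs => hs.1.2⟩).2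

theorem toReal_setLIntegral_Ioc_add_le {α : ℝ → ℝ≥0∞} {v u : ℝ} (hv : 0 ≤ v) (hvu : v ≤ u)
    (hα : ∀ s ∈ Set.Ioc v u, α u ≤ α s) (hI : (∫⁻ s in Set.Ioc 0 u, α s) ≠ ⊤) :
    (∫⁻ s in Set.Ioc 0 v, α s).toReal + (α u).toReal * (u - v) ≤
      (∫⁻ s in Set.Ioc 0 u, α s).toReal := by
  have hsplit : ∫⁻ s in Set.Ioc 0 u, α s =
      (∫⁻ s in Set.Ioc 0 v, α s) + ∫⁻ s in Set.Ioc v u, α s := by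
    rw [← Set.Ioc_union_Ioc_eq_Ioc hv hvu]
    exact lintegral_union measurableSet_Ioc (Set.Ioc_disjoint_Ioc_of_le le_rfl)
  have hv_fin : (∫⁻ s in Set.Ioc 0 v, α s) ≠ ⊤ := fun h => hI (by rw [hsplit, h, top_add])
  have hvu_fin : (∫⁻ s in Set.Ioc v u, α s) ≠ ⊤ := fun h => hI (by rw [hsplit, h, add_top])
  have hle : α u * ENNReal.ofReal (u - v) ≤ ∫⁻ s in Set.Ioc v u, α s := by
    rw [← Real.volume_Ioc, ← setLIntegral_const]
    exact setLIntegral_mono' measurableSet_Ioc hα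
  have hle' := ENNReal.toReal_mono hvu_fin hle
  rw [ENNReal.toReal_mul, ENNReal.toReal_ofReal (sub_nonneg.2 hvu)] at hle'
  rw [hsplit, ENNReal.toReal_add hv_fin hvu_fin]
  linarith

theorem two_mul_sqrt_le_sqrt_add {c p q : ℝ} (hc : 0 < c) (hcp : c⁻¹ ^ 2 ≤ p) (hq : 0 ≤ q) :
    2 * √q ≤ √p + c * q := by
  have h1 : c⁻¹ ≤ √p := Real.le_sqrt_of_sq_le hcp
  have h2 : c⁻¹ + c * q - 2 * √q = c⁻¹ * (1 - c * √q) ^ 2 := by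
    nth_rewrite 1 [← Real.sq_sqrt hq]
    field_simp
    ring
  have h3 : 0 ≤ c⁻¹ * (1 - c * √q) ^ 2 := by positivity
  linarith

/-- The telescoping estimate for two consecutive gaps of the `sigmaAlpha` iteration. -/
theorem two_mul_sqrt_sigmaAlpha_gap_le {η : ℝ} {α : ℝ → ℝ≥0∞}
    (hcont : ContinuousOn α (Set.Ico 0 η))
    (hmono : ∀ s ∈ Set.Ico (0 : ℝ) η, ∀ t ∈ Set.Ico (0 : ℝ) η, s ≤ t → α t ≤ α s)
    (hpos : ∀ t ∈ Set.Ico (0 : ℝ) η, 0 < α t)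
    (hfin : ∀ t ∈ Set.Ioo (0 : ℝ) η, α t ≠ ⊤)
    (hI : (∫⁻ t in Set.Ioo (0 : ℝ) η, α t) ≠ ⊤) {t : ℝ} (ht : t ∈ Set.Ico 0 η) :
    2 * √(sigmaAlpha α t - sigmaAlpha α (sigmaAlpha α t)) +
        (∫⁻ s in Set.Ioc 0 (sigmaAlpha α (sigmaAlpha α t)), α s).toReal ≤
      √(t - sigmaAlpha α t) + (∫⁻ s in Set.Ioc 0 (sigmaAlpha α t), α s).toReal := by
  obtain ⟨hu0, hut⟩ := sigmaAlpha_mem_Icc α ht.1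
  obtain ⟨hv0, hvu⟩ := sigmaAlpha_mem_Icc α hu0
  have hattained := inv_sq_sigmaAlpha_le (hcont.mono (Set.Icc_subset_Ico_right ht.2))
  generalize sigmaAlpha α (sigmaAlpha α t) = v at *
  generalize sigmaAlpha α t = u at *
  have huη : u < η := hut.trans_lt ht.2
  rcases hvu.eq_or_lt with rfl | hlt
  · simp
  have hu : 0 < u := hv0.trans_lt hlt
  have hI' : (∫⁻ s in Set.Ioc 0 u, α s) ≠ ⊤ :=
    ne_top_of_le_ne_top hI (lintegral_mono_set fun s hs => ⟨hs.1, hs.2.trans_lt huη⟩)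
  have hc : 0 < (α u).toReal := ENNReal.toReal_pos (hpos u ⟨hu0, huη⟩).ne' (hfin u ⟨hu, huη⟩)
  have hcp : (α u).toReal⁻¹ ^ 2 ≤ t - u := by
    have h := ENNReal.toReal_mono ENNReal.ofReal_ne_top (hattained hu)
    rwa [ENNReal.toReal_pow, ENNReal.toReal_inv,
      ENNReal.toReal_ofReal (sub_nonneg.2 hut)] at h
  have h1 := two_mul_sqrt_le_sqrt_add hc hcp (sub_nonneg.2 hvu)
  have h2 := toReal_setLIntegral_Ioc_add_le hv0 hvu
    (fun s hs => hmono s ⟨hv0.trans hs.1.le, hs.2.trans_lt huη⟩ u ⟨hu0, huη⟩ hs.2) hI'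
  linarith

/-- Lemma 8.6: if `α : [0,η) → (0,∞]` is continuous, nonincreasing, finite on
`(0,η)` and `I = ∫₀^η α < ∞`, then for every `f₀ ∈ [0,η)`,
`Σ_{s=0}^∞ √(σ_α^{(s)}(f₀) − σ_α^{(s+1)}(f₀)) ≤ I + 2√(f₀ − σ_α(f₀))`. -/
theorem sum_sqrt_sigma_le_integral_add
    (η : ℝ) (hη : 0 < η) (α : ℝ → ℝ≥0∞)
    (hcont : ContinuousOn α (Set.Ico 0 η))
    (hmono : ∀ s ∈ Set.Ico (0 : ℝ) η, ∀ t ∈ Set.Ico (0 : ℝ) η, s ≤ t → α t ≤ α s)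
    (hpos : ∀ t ∈ Set.Ico (0 : ℝ) η, 0 < α t)
    (hfin : ∀ t ∈ Set.Ioo (0 : ℝ) η, α t ≠ ⊤)
    (hI : (∫⁻ t in Set.Ioo (0 : ℝ) η, α t) ≠ ⊤)
    (f₀ : ℝ) (hf₀ : f₀ ∈ Set.Ico 0 η) :
    Summable (fun s : ℕ =>
      Real.sqrt ((sigmaAlpha α)^[s] f₀ - (sigmaAlpha α)^[s + 1] f₀)) ∧
    ∑' s : ℕ, Real.sqrt ((sigmaAlpha α)^[s] f₀ - (sigmaAlpha α)^[s + 1] f₀)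
      ≤ (∫⁻ t in Set.Ioo (0 : ℝ) η, α t).toReal + 2 * Real.sqrt (f₀ - sigmaAlpha α f₀) := by
  have hmem : ∀ n, (sigmaAlpha α)^[n] f₀ ∈ Set.Ico 0 η := by
    intro n
    induction n with
    | zero => exact hf₀
    | succ n ih =>
      rw [Function.iterate_succ_apply']
      have h := sigmaAlpha_mem_Icc α ih.1
      exact ⟨h.1, h.2.trans_lt ih.2⟩
  have hsum : ∀ n, ∑ s ∈ Finset.range (n + 1),
        √((sigmaAlpha α)^[s] f₀ - (sigmaAlpha α)^[s + 1] f₀) +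
        √((sigmaAlpha α)^[n] f₀ - (sigmaAlpha α)^[n + 1] f₀) +
        (∫⁻ t in Set.Ioc 0 ((sigmaAlpha α)^[n + 1] f₀), α t).toReal ≤
      2 * √(f₀ - sigmaAlpha α f₀) + (∫⁻ t in Set.Ioc 0 (sigmaAlpha α f₀), α t).toReal := by
    intro n
    induction n with
    | zero => simp [two_mul]
    | succ n ih =>
      have h := two_mul_sqrt_sigmaAlpha_gap_le hcont hmono hpos hfin hI (hmem n)
      rw [← Function.iterate_succ_apply' (sigmaAlpha α) n,
        ← Function.iterate_succ_apply' (sigmaAlpha α) (n + 1)] at h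
      rw [Finset.sum_range_succ]
      linarith
  have hσ := sigmaAlpha_mem_Icc α hf₀.1
  have hI_le : (∫⁻ t in Set.Ioc 0 (sigmaAlpha α f₀), α t).toReal ≤
      (∫⁻ t in Set.Ioo (0 : ℝ) η, α t).toReal :=
    ENNReal.toReal_mono hI
      (lintegral_mono_set fun s hs => ⟨hs.1, (hs.2.trans hσ.2).trans_lt hf₀.2⟩)
  have hbound : ∀ n, ∑ s ∈ Finset.range n,
        √((sigmaAlpha α)^[s] f₀ - (sigmaAlpha α)^[s + 1] f₀) ≤
      (∫⁻ t in Set.Ioo (0 : ℝ) η, α t).toReal + 2 * √(f₀ - sigmaAlpha α f₀) := by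
    intro n
    have h1 := hsum n
    rw [Finset.sum_range_succ] at h1
    have h2 := Real.sqrt_nonneg ((sigmaAlpha α)^[n] f₀ - (sigmaAlpha α)^[n + 1] f₀)
    have h3 : 0 ≤ (∫⁻ t in Set.Ioc 0 ((sigmaAlpha α)^[n + 1] f₀), α t).toReal :=
      ENNReal.toReal_nonneg
    linarith
  exact ⟨summable_of_sum_range_le (fun _ => Real.sqrt_nonneg _) hbound,
    Real.tsum_le_of_sum_range_le (fun _ => Real.sqrt_nonneg _) hbound⟩
end

section
/- Let a, b > 0, η > 0, let φ be a desingularizing function on [0,η), and set α(t) = (b/√a)·φ'(t) for t ∈ (0,η). Let {x_k}_{k≥0} and {x̃_k}_{k≥0} be sequences in ℝⁿ and let {F_k}, {F̃_k}, {D_k} be real sequences with F_k ≥ 0, D_k ≥ 0, F₀ < η, satisfying for every k: (H1) F_{k+1} + a‖x_{k+1} − x_k‖² ≤ F_k; (H'2) F_k − F_{k+1} ≥ (a/b²)·D_k²; F_{k+1} ≤ F̃_k ≤ F_k − a‖x̃_k − x_k‖²; and the KL inequality φ'(F̃_k)·D_k ≥ 1 whenever F̃_k > 0. Then for every k: F_k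 ≤ σ_α^{(k)}(F₀), and Σ_{i=k}^∞ ‖x_i − x_{i+1}‖ ≤ (b/a)·φ(F_k) + 2√((F_k − σ_α(F_k))/a). -/
open scoped ENNReal

/-- The function `α(t) = (b/√a)·φ'(t)` for `t > 0`, extended by `∞` at `t ≤ 0`. -/
noncomputable def klAlpha (a b : ℝ) (φ' : ℝ → ℝ) : ℝ → ℝ≥0∞ :=
  fun t => if 0 < t then ENNReal.ofReal ((b / Real.sqrt a) * φ' t) else ⊤

lemma sigmaAlpha_bddAbove (α : ℝ → ℝ≥0∞) (t : ℝ) :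
    BddAbove {s : ℝ | s ∈ Set.Icc 0 t ∧ (α s)⁻¹ ^ 2 ≤ ENNReal.ofReal (t - s)} :=
  ⟨t, fun _ hs => hs.1.2⟩

lemma sigmaAlpha_mono (α : ℝ → ℝ≥0∞) : Monotone (sigmaAlpha α) := by
  intro t t' htt'
  rcases Set.eq_empty_or_nonempty
    {s : ℝ | s ∈ Set.Icc 0 t ∧ (α s)⁻¹ ^ 2 ≤ ENNReal.ofReal (t - s)} with h | h
  · unfold sigmaAlpha
    rw [h, Real.sSup_empty]
    exact Real.sSup_nonneg fun s hs => hs.1.1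
  · refine csSup_le_csSup (sigmaAlpha_bddAbove α t') h ?_
    rintro s ⟨⟨hs0, hst⟩, hs⟩
    exact ⟨⟨hs0, hst.trans htt'⟩, hs.trans (ENNReal.ofReal_le_ofReal (by linarith))⟩

/-- For `c > 0`, the condition `1/c² ≤ r` in `ℝ≥0∞` is the real inequality `1 ≤ c √r`. -/
lemma ENNReal.ofReal_inv_sq_le_iff {c r : ℝ} (hc : 0 < c) :
    (ENNReal.ofReal c)⁻¹ ^ 2 ≤ ENNReal.ofReal r ↔ 1 ≤ c * Real.sqrt r := by
  rw [← ENNReal.ofReal_inv_of_pos hc, ← ENNReal.ofReal_pow (by positivity),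
    ENNReal.ofReal_le_ofReal_iff', or_iff_left (not_le.2 (by positivity)),
    ← Real.le_sqrt' (by positivity), inv_le_iff_one_le_mul₀' hc]

/-- A concave function on a convex set lies below its tangent lines. -/
lemma ConcaveOn.le_tangent {S : Set ℝ} {f : ℝ → ℝ} {f' s t : ℝ} (hf : ConcaveOn ℝ S f)
    (hs : s ∈ S) (ht : t ∈ S) (hd : HasDerivAt f f' s) : f t ≤ f s + f' * (t - s) := by
  rcases lt_trichotomy s t with h | rfl | h
  · have := hf.slope_le_of_hasDerivAt hs ht h hd
    rw [slope_def_field, div_le_iff₀ (sub_pos.2 h)] at this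
    linarith
  · simp
  · have := hf.le_slope_of_hasDerivAt ht hs h hd
    rw [slope_def_field, le_div_iff₀ (sub_pos.2 h)] at this
    linarith

/-- If `2 u_{i+1} ≤ u_i + (w_i - w_{i+1})` with nonnegative terms, then all partial sums of `u`
are at most `2 u_0 + w_0`. -/
lemma sum_range_le_of_two_mul_le {u w : ℕ → ℝ} (hu : ∀ i, 0 ≤ u i) (hw : ∀ i, 0 ≤ w i)
    (h : ∀ i, 2 * u (i + 1) ≤ u i + (w i - w (i + 1))) (m : ℕ) :
    ∑ i ∈ Finset.range m, u i ≤ 2 * u 0 + w 0 := by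
  have key : ∑ i ∈ Finset.range (m + 1), u i + u m + w m ≤ 2 * u 0 + w 0 := by
    induction m with
    | zero => simp [two_mul]
    | succ m ih =>
      rw [Finset.sum_range_succ]
      linarith [h m]
  rw [Finset.sum_range_succ] at key
  linarith [hu m, hw m]

/-- Lemma 8.7: abstract convergence rates under (H1), (H'2), the sandwich
condition and the KL inequality, for a desingularizing function `φ` on `[0,η)` and
`α(t) = (b/√a)·φ'(t)`:  `F_k ≤ σ_α^{(k)}(F₀)` and the tail length bound
`Σ_{i=k}^∞ ‖x_i − x_{i+1}‖ ≤ (b/a)·φ(F_k) + 2√((F_k − σ_α(F_k))/a)`. -/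
theorem abstract_descent_rates
    {n : ℕ} (a b η : ℝ) (ha : 0 < a) (hb : 0 < b) (hη : 0 < η)
    (φ φ' : ℝ → ℝ)
    (hφcont : ContinuousOn φ (Set.Ico 0 η))
    (hφconc : ConcaveOn ℝ (Set.Ico 0 η) φ)
    (hφ0 : φ 0 = 0)
    (hφnonneg : ∀ t ∈ Set.Ico (0 : ℝ) η, 0 ≤ φ t)
    (hφderiv : ∀ t ∈ Set.Ioo (0 : ℝ) η, HasDerivAt φ (φ' t) t)
    (hφ'pos : ∀ t ∈ Set.Ioo (0 : ℝ) η, 0 < φ' t)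
    (x xt : ℕ → EuclideanSpace ℝ (Fin n))
    (F Ft D : ℕ → ℝ)
    (hFnonneg : ∀ k, 0 ≤ F k) (hDnonneg : ∀ k, 0 ≤ D k) (hF0 : F 0 < η)
    (hH1 : ∀ k, F (k + 1) + a * ‖x (k + 1) - x k‖ ^ 2 ≤ F k)
    (hH'2 : ∀ k, F k - F (k + 1) ≥ (a / b ^ 2) * D k ^ 2)
    (hsandwich : ∀ k, F (k + 1) ≤ Ft k ∧ Ft k ≤ F k - a * ‖xt k - x k‖ ^ 2)
    (hKL : ∀ k, 0 < Ft k → 1 ≤ φ' (Ft k) * D k) :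
    ∀ k : ℕ,
      F k ≤ (sigmaAlpha (klAlpha a b φ'))^[k] (F 0) ∧
      Summable (fun i : ℕ => ‖x (k + i) - x (k + i + 1)‖) ∧
      ∑' i : ℕ, ‖x (k + i) - x (k + i + 1)‖
        ≤ (b / a) * φ (F k)
          + 2 * Real.sqrt ((F k - sigmaAlpha (klAlpha a b φ') (F k)) / a) := by
  set α := klAlpha a b φ' with hα
  set C := b / Real.sqrt a with hC
  have hsa : 0 < Real.sqrt a := Real.sqrt_pos.2 ha
  have hCpos : 0 < C := by positivity
  have hstep : ∀ k, F (k + 1) ≤ F k := fun k => by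
    have := hH1 k
    have : 0 ≤ a * ‖x (k + 1) - x k‖ ^ 2 := by positivity
    linarith
  have hFη : ∀ k, F k < η := fun k =>
    (antitone_nat_of_succ_le hstep (Nat.zero_le k)).trans_lt hF0
  have htan : ∀ s t, 0 < s → s < η → 0 ≤ t → t < η → φ t ≤ φ s + φ' s * (t - s) :=
    fun s t hs hs' ht ht' =>
      hφconc.le_tangent ⟨hs.le, hs'⟩ ⟨ht, ht'⟩ (hφderiv s ⟨hs, hs'⟩)
  have hanti : ∀ s t, 0 < s → s ≤ t → t < η → φ' t ≤ φ' s := by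
    intro s t hs hst ht
    rcases hst.eq_or_lt with rfl | hlt
    · exact le_rfl
    · have h1 := htan s t hs (hst.trans_lt ht) (hs.le.trans hst) ht
      have h2 := htan t s (hs.trans hlt) ht hs.le (hst.trans_lt ht)
      nlinarith
  have hmono : ∀ s t, 0 ≤ s → s ≤ t → t < η → φ s ≤ φ t := by
    intro s t hs hst ht
    rcases hst.eq_or_lt with rfl | hlt
    · exact le_rfl
    · have h1 := htan t s (hs.trans_lt hlt) ht hs (hst.trans_lt ht)
      have h2 := hφ'pos t ⟨hs.trans_lt hlt, ht⟩
      nlinarith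
  have hmem : ∀ s r, 0 < s → s < η →
      ((α s)⁻¹ ^ 2 ≤ ENNReal.ofReal r ↔ 1 ≤ C * φ' s * Real.sqrt r) := by
    intro s r hs hs'
    rw [hα, klAlpha, if_pos hs]
    exact ENNReal.ofReal_inv_sq_le_iff (mul_pos hCpos (hφ'pos s ⟨hs, hs'⟩))
  have hkl : ∀ k, 0 < F (k + 1) → 1 ≤ C * φ' (F (k + 1)) * Real.sqrt (F k - F (k + 1)) := by
    intro k hpos
    have hFt : F (k + 1) ≤ Ft k := (hsandwich k).1
    have hFt' : Ft k < η := by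
      have h1 := (hsandwich k).2
      have h2 : 0 ≤ a * ‖xt k - x k‖ ^ 2 := by positivity
      linarith [hFη k]
    have h1 := hKL k (hpos.trans_le hFt)
    have hD : Real.sqrt a / b * D k ≤ Real.sqrt (F k - F (k + 1)) := by
      apply Real.le_sqrt_of_sq_le
      rw [mul_pow, div_pow, Real.sq_sqrt ha.le]
      exact hH'2 k
    have hφp := hφ'pos _ ⟨hpos, hFη (k + 1)⟩
    calc 1 ≤ φ' (Ft k) * D k := h1
      _ ≤ φ' (F (k + 1)) * D k :=
        mul_le_mul_of_nonneg_right (hanti _ _ hpos hFt hFt') (hDnonneg k)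
      _ = C * φ' (F (k + 1)) * (Real.sqrt a / b * D k) := by rw [hC]; field_simp
      _ ≤ _ := by gcongr
  have hFmem : ∀ k, F (k + 1) ∈
      {s : ℝ | s ∈ Set.Icc 0 (F k) ∧ (α s)⁻¹ ^ 2 ≤ ENNReal.ofReal (F k - s)} := by
    intro k
    refine ⟨⟨hFnonneg _, hstep k⟩, ?_⟩
    rcases (hFnonneg (k + 1)).eq_or_lt with h0 | hpos
    · simp [← h0, hα, klAlpha]
    · exact (hmem _ _ hpos (hFη _)).2 (hkl k hpos)
  have hFσ : ∀ k, F (k + 1) ≤ sigmaAlpha α (F k) := fun k =>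
    le_csSup (sigmaAlpha_bddAbove α _) (hFmem k)
  have hexch : ∀ k, C * φ (F (k + 1)) + 2 * Real.sqrt (F k - F (k + 1)) ≤
      C * φ (F k) + 2 * Real.sqrt (F k - sigmaAlpha α (F k)) := by
    intro k
    have hs : ∀ s ∈ {s : ℝ | s ∈ Set.Icc 0 (F k) ∧ (α s)⁻¹ ^ 2 ≤ ENNReal.ofReal (F k - s)},
        F (k + 1) < s → C * φ (F (k + 1)) + 2 * Real.sqrt (F k - F (k + 1)) ≤
          C * φ (F k) + 2 * Real.sqrt (F k - s) := by
      rintro s ⟨⟨-, hsk⟩, hs⟩ hlt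
      have hs0 : 0 < s := (hFnonneg _).trans_lt hlt
      have hsη : s < η := hsk.trans_lt (hFη k)
      have h1 := (hmem s _ hs0 hsη).1 hs
      have h2 := htan s (F (k + 1)) hs0 hsη (hFnonneg _) (hFη _)
      have h3 := hmono s (F k) hs0.le hsk (hFη k)
      have h4 : Real.sqrt (F k - s) ≤ Real.sqrt (F k - F (k + 1)) :=
        Real.sqrt_le_sqrt (by linarith)
      have h5 := Real.sq_sqrt (sub_nonneg.2 hsk)
      have h6 := Real.sq_sqrt (sub_nonneg.2 (hstep k))
      have h7 := Real.sqrt_nonneg (F k - s)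
      have hc : 0 < C * φ' s := mul_pos hCpos (hφ'pos s ⟨hs0, hsη⟩)
      have h8 : C * φ (F (k + 1)) ≤ C * φ s + C * φ' s * (F (k + 1) - s) := by
        calc _ ≤ C * (φ s + φ' s * (F (k + 1) - s)) := by gcongr
          _ = _ := by ring
      have h9 : C * φ s ≤ C * φ (F k) := by gcongr
      set p := Real.sqrt (F k - s)
      set q := Real.sqrt (F k - F (k + 1))
      have h10 : 2 * (q - p) ≤ C * φ' s * (q ^ 2 - p ^ 2) := by
        have : 2 ≤ C * φ' s * (q + p) := by nlinarith
        nlinarith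
      have h11 : q ^ 2 - p ^ 2 = s - F (k + 1) := by rw [h5, h6]; ring
      rw [h11] at h10
      nlinarith
    rcases (hFσ k).eq_or_lt with heq | hlt
    · rw [← heq]
      have := hmono _ _ (hFnonneg (k + 1)) (hstep k) (hFη k)
      gcongr
    · have hcont : Continuous fun s => C * φ (F k) + 2 * Real.sqrt (F k - s) := by fun_prop
      obtain ⟨v, -, hv, hvmem⟩ := exists_seq_tendsto_sSup ⟨_, hFmem k⟩
        (sigmaAlpha_bddAbove α (F k))
      refine ge_of_tendsto ((hcont.tendsto _).comp hv) ?_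
      filter_upwards [hv.eventually_const_lt hlt] with i hi using hs _ (hvmem i) hi
  have hrec : ∀ k, 2 * Real.sqrt (F (k + 1) - F (k + 2)) ≤
      Real.sqrt (F k - F (k + 1)) + (C * φ (F (k + 1)) - C * φ (F (k + 2))) := by
    intro k
    have hnn := hFnonneg (k + 2)
    have hle : F (k + 2) ≤ F (k + 1) := hstep (k + 1)
    rcases (hFnonneg (k + 1)).eq_or_lt with h0 | hpos
    · have h2 : F (k + 2) = 0 := by linarith
      simp [← h0, h2]
    · have h1 := hkl k hpos
      have h2 := htan _ (F (k + 2)) hpos (hFη _) hnn (hFη _)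
      have h3 := Real.sq_sqrt (sub_nonneg.2 hle)
      have h4 : C * φ (F (k + 2)) ≤
          C * φ (F (k + 1)) + C * φ' (F (k + 1)) * (F (k + 2) - F (k + 1)) := by
        calc _ ≤ C * (φ (F (k + 1)) + φ' (F (k + 1)) * (F (k + 2) - F (k + 1))) := by gcongr
          _ = _ := by ring
      have hc := mul_pos hCpos (hφ'pos _ ⟨hpos, hFη (k + 1)⟩)
      have hu := Real.sqrt_nonneg (F k - F (k + 1))
      set c := C * φ' (F (k + 1))
      set u := Real.sqrt (F k - F (k + 1))
      set v := Real.sqrt (F (k + 1) - F (k + 2))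
      have h5 : 2 * v ≤ u + c * v ^ 2 := by
        have : 0 ≤ c * (u + c * v ^ 2 - 2 * v) := by nlinarith [sq_nonneg (c * v - 1)]
        nlinarith [nonneg_of_mul_nonneg_right this hc]
      rw [h3] at h5
      linarith
  have hdist : ∀ k, ‖x k - x (k + 1)‖ ≤ Real.sqrt (F k - F (k + 1)) / Real.sqrt a := by
    intro k
    rw [← Real.sqrt_div' _ ha.le, norm_sub_rev]
    apply Real.le_sqrt_of_sq_le
    rw [le_div_iff₀ ha]
    linarith [hH1 k]
  intro k
  refine ⟨?_, ?_⟩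
  · induction k with
    | zero => exact le_rfl
    | succ k ih =>
      rw [Function.iterate_succ_apply']
      exact (hFσ k).trans (sigmaAlpha_mono α ih)
  · have hbound : ∀ m, ∑ i ∈ Finset.range m, ‖x (k + i) - x (k + i + 1)‖ ≤
        (b / a) * φ (F k) + 2 * Real.sqrt ((F k - sigmaAlpha α (F k)) / a) := by
      intro m
      have h1 := sum_range_le_of_two_mul_le
        (u := fun i => Real.sqrt (F (k + i) - F (k + i + 1)))
        (w := fun i => C * φ (F (k + i + 1))) (fun i => Real.sqrt_nonneg _)
        (fun i => mul_nonneg hCpos.le (hφnonneg _ ⟨hFnonneg _, hFη _⟩))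
        (fun i => hrec (k + i)) m
      simp only [add_zero] at h1
      calc ∑ i ∈ Finset.range m, ‖x (k + i) - x (k + i + 1)‖
          ≤ ∑ i ∈ Finset.range m, Real.sqrt (F (k + i) - F (k + i + 1)) / Real.sqrt a :=
            Finset.sum_le_sum fun i _ => hdist (k + i)
        _ = (∑ i ∈ Finset.range m, Real.sqrt (F (k + i) - F (k + i + 1))) / Real.sqrt a := by
            rw [Finset.sum_div]
        _ ≤ (C * φ (F k) + 2 * Real.sqrt (F k - sigmaAlpha α (F k))) / Real.sqrt a := by
            gcongr
            linarith [hexch k]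
        _ = _ := by
            rw [Real.sqrt_div' _ ha.le, hC, add_div, mul_div_assoc 2, div_mul_eq_mul_div,
              div_div, Real.mul_self_sqrt ha.le, div_mul_eq_mul_div]
    exact ⟨summable_of_sum_range_le (fun _ => norm_nonneg _) hbound,
      Real.tsum_le_of_sum_range_le (fun _ => norm_nonneg _) hbound⟩
end

section
/- Let a, b, M > 0, θ ∈ (0, 1/2), r = 1/(1 − 2θ), and define α(t) = (bM/√a)·t^{θ−1} for t > 0 (with α(0) = +∞). Let f₀ ≥ 0 and P = max( f₀, (2^{r+2}·r·b²M²/a)^r ). Then for every integer k ≥ 0: σ_α^{(k)}(f₀) ≤ P/(k+1)^r. -/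
open scoped ENNReal

/-- `α(t) = (bM/√a)·t^(θ−1)` for `t > 0`, with `α(t) = ∞` for `t ≤ 0`. -/
noncomputable def powAlpha (a b M θ : ℝ) : ℝ → ℝ≥0∞ :=
  fun t => if 0 < t then ENNReal.ofReal ((b * M / Real.sqrt a) * t ^ (θ - 1)) else ⊤

/-- A positive feasible `s` in the definition of `sigmaAlpha (powAlpha a b M θ) t` satisfies the
real inequality `a * s ^ (2 - 2θ) / (b² M²) ≤ t - s`. -/
theorem powAlpha_feasible_real {a b M θ s t : ℝ} (ha : 0 < a) (hb : 0 < b) (hM : 0 < M)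
    (hs : 0 < s) (hst : s ≤ t)
    (h : (powAlpha a b M θ s)⁻¹ ^ 2 ≤ ENNReal.ofReal (t - s)) :
    a / (b ^ 2 * M ^ 2) * s ^ (2 - 2 * θ) ≤ t - s := by
  have hsa : 0 < Real.sqrt a := Real.sqrt_pos.2 ha
  have hpos : 0 < b * M / Real.sqrt a * s ^ (θ - 1) := by positivity
  rw [powAlpha, if_pos hs, ← ENNReal.ofReal_inv_of_pos hpos,
    ← ENNReal.ofReal_pow (by positivity), ENNReal.ofReal_le_ofReal_iff (by linarith)] at h
  refine le_of_eq_of_le ?_ h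
  have hexp : s ^ (2 - 2 * θ) = ((s ^ (θ - 1)) ^ 2)⁻¹ := by
    rw [← Real.rpow_natCast, ← Real.rpow_mul hs.le, ← Real.rpow_neg hs.le]
    congr 1
    push_cast
    ring
  rw [hexp, inv_pow, mul_pow, div_pow, mul_pow, Real.sq_sqrt ha.le, mul_inv, inv_div]

/-- The relative decrease of `x ↦ x ^ (-r)` from `x` to `x + 1`, for `x ≥ 1` and `r ≥ 1`. -/
theorem inv_rpow_le_inv_rpow_add_one_mul {r x : ℝ} (hr : 1 ≤ r) (hx : 1 ≤ x) :
    1 / x ^ r ≤ 1 / (x + 1) ^ r * (1 + 2 ^ r * r / (x + 1)) := by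
  have hX : 0 < x ^ r := by positivity
  have hY : 0 < (x + 1) ^ r := by positivity
  have hbern : 1 - r / (x + 1) ≤ x ^ r / (x + 1) ^ r := by
    have h := one_add_mul_self_le_rpow_one_add (s := -1 / (x + 1))
      (by rw [le_div_iff₀ (by positivity)]; linarith) hr
    rw [← Real.div_rpow (by positivity) (by positivity)]
    convert h using 1
    · ring
    · congr 1
      field_simp
      ring
  have hdouble : (x + 1) ^ r ≤ 2 ^ r * x ^ r := by
    rw [← Real.mul_rpow (by norm_num) (by positivity)]
    exact Real.rpow_le_rpow (by positivity) (by linarith) (by linarith)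
  have hratio : 1 ≤ 2 ^ r * (x ^ r / (x + 1) ^ r) := by
    rw [← mul_div_assoc, one_le_div hY]
    exact hdouble
  have hfrac : 0 ≤ r / (x + 1) := by positivity
  have hmul := mul_le_mul_of_nonneg_left hratio hfrac
  have key : 1 ≤ x ^ r / (x + 1) ^ r * (1 + 2 ^ r * r / (x + 1)) := by
    calc 1 ≤ x ^ r / (x + 1) ^ r + r / (x + 1) * 1 := by linarith
      _ ≤ x ^ r / (x + 1) ^ r + r / (x + 1) * (2 ^ r * (x ^ r / (x + 1) ^ r)) := by linarith
      _ = _ := by ring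
  rw [div_le_iff₀ hX]
  calc 1 ≤ _ := key
    _ = _ := by ring

/-- One application of `sigmaAlpha (powAlpha a b M θ)` improves the bound `P / x ^ r` to
`P / (x + 1) ^ r`. -/
theorem sigmaAlpha_powAlpha_le {a b M θ r P t x : ℝ} (ha : 0 < a) (hb : 0 < b) (hM : 0 < M)
    (hr1 : 1 ≤ r) (hθr : 2 - 2 * θ = 1 + 1 / r)
    (hP : (2 ^ (r + 2) * r * b ^ 2 * M ^ 2 / a) ^ r ≤ P)
    (hx : 1 ≤ x) (ht : t ≤ P / x ^ r) :
    sigmaAlpha (powAlpha a b M θ) t ≤ P / (x + 1) ^ r := by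
  set D := 2 ^ (r + 2) * r * b ^ 2 * M ^ 2 / a with hD
  have hr0 : 0 < r := by linarith
  have hDpos : 0 < D := by positivity
  have hPpos : 0 < P := lt_of_lt_of_le (by positivity) hP
  set q := P / (x + 1) ^ r with hq
  have hqpos : 0 < q := by positivity
  refine Real.sSup_le ?_ hqpos.le
  rintro s ⟨⟨-, hst⟩, hs⟩
  by_contra! hqs
  have hreal := powAlpha_feasible_real ha hb hM (hqpos.trans hqs) hst hs
  have hroot : D / (x + 1) ≤ q ^ (1 / r) := by
    have h : (D / (x + 1)) ^ r ≤ q := by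
      rw [Real.div_rpow hDpos.le (by positivity)]
      exact div_le_div_of_nonneg_right hP (by positivity)
    calc D / (x + 1) = ((D / (x + 1)) ^ r) ^ (1 / r) := by
          rw [← Real.rpow_mul (by positivity), mul_one_div_cancel hr0.ne', Real.rpow_one]
      _ ≤ q ^ (1 / r) := Real.rpow_le_rpow (by positivity) h (by positivity)
  have hlower : q * (2 ^ (r + 2) * r / (x + 1)) ≤ a / (b ^ 2 * M ^ 2) * s ^ (2 - 2 * θ) := by
    calc q * (2 ^ (r + 2) * r / (x + 1)) = a / (b ^ 2 * M ^ 2) * (q * (D / (x + 1))) := by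
          rw [hD]
          field_simp
      _ ≤ a / (b ^ 2 * M ^ 2) * (q * q ^ (1 / r)) := by gcongr
      _ = a / (b ^ 2 * M ^ 2) * q ^ (2 - 2 * θ) := by
          rw [hθr, Real.rpow_add hqpos, Real.rpow_one]
      _ ≤ a / (b ^ 2 * M ^ 2) * s ^ (2 - 2 * θ) := by
          have : 0 ≤ 2 - 2 * θ := by rw [hθr]; positivity
          gcongr
  have hupper : P / x ^ r ≤ q * (1 + 2 ^ r * r / (x + 1)) := by
    have h := mul_le_mul_of_nonneg_left (inv_rpow_le_inv_rpow_add_one_mul hr1 hx) hPpos.le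
    calc P / x ^ r = P * (1 / x ^ r) := by ring
      _ ≤ _ := h
      _ = _ := by rw [hq]; ring
  have hpow : q * (2 ^ r * r / (x + 1)) ≤ q * (2 ^ (r + 2) * r / (x + 1)) := by
    gcongr
    · norm_num
    · linarith
  linarith

/-- for `θ ∈ (0, 1/2)`, `r = 1/(1−2θ)`, `α(t) = (bM/√a)·t^(θ−1)` and
`P = max(f₀, (2^(r+2)·r·b²M²/a)^r)`, one has `σ_α^{(k)}(f₀) ≤ P/(k+1)^r` for all `k`. -/
theorem sigma_iterates_polynomial_decay
    (a b M θ : ℝ) (ha : 0 < a) (hb : 0 < b) (hM : 0 < M)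
    (hθ0 : 0 < θ) (hθ : θ < 1 / 2)
    (r : ℝ) (hr : r = 1 / (1 - 2 * θ))
    (f₀ : ℝ) (hf₀ : 0 ≤ f₀)
    (P : ℝ) (hP : P = max f₀ ((2 ^ (r + 2) * r * b ^ 2 * M ^ 2 / a) ^ r)) :
    ∀ k : ℕ, (sigmaAlpha (powAlpha a b M θ))^[k] f₀ ≤ P / ((k : ℝ) + 1) ^ r := by
  have h0 : 0 < 1 - 2 * θ := by linarith
  have hr1 : 1 ≤ r := by
    rw [hr, le_div_iff₀ h0]
    linarith
  have hθr : 2 - 2 * θ = 1 + 1 / r := by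
    rw [hr, one_div_one_div]
    ring
  intro k
  induction k with
  | zero => simp [hP]
  | succ k ih =>
    rw [Function.iterate_succ_apply', Nat.cast_succ]
    exact sigmaAlpha_powAlpha_le ha hb hM hr1 hθr (hP ▸ le_max_right _ _)
      (le_add_of_nonneg_left k.cast_nonneg) ih
end

section
/- Let h : ℝⁿ → ℝ be differentiable, μ-strongly convex, and with L-Lipschitz gradient (0 < μ ≤ L). Let x̄, y ∈ ℝⁿ with x̄ ≠ y and h(x̄) = h(y). Then ⟨∇h(y), y − x̄⟩ ≥ (μ/2)‖y − x̄‖², ∇h(x̄) ≠ ∇h(y), and ⟨∇h(y), y − x̄⟩ / (‖∇h(x̄) − ∇h(y)‖·‖y − x̄‖) ≥ μ/(2L). -/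
open scoped RealInnerProductSpace

/-- if `h` is differentiable, `μ`-strongly convex with `L`-Lipschitz gradient
(`0 < μ ≤ L`), and `x̄ ≠ y` with `h(x̄) = h(y)`, then `⟨∇h(y), y − x̄⟩ ≥ (μ/2)‖y − x̄‖²`,
`∇h(x̄) ≠ ∇h(y)`, and `⟨∇h(y), y − x̄⟩/(‖∇h(x̄) − ∇h(y)‖·‖y − x̄‖) ≥ μ/(2L)`. -/
theorem level_set_slope_bound
    {n : ℕ} (h : EuclideanSpace ℝ (Fin n) → ℝ)
    (h' : EuclideanSpace ℝ (Fin n) → EuclideanSpace ℝ (Fin n))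
    (hgrad : ∀ x, HasGradientAt h (h' x) x)
    (μ L : ℝ) (hμ : 0 < μ) (hμL : μ ≤ L)
    (hsc : ∀ x y, h y ≥ h x + ⟪h' x, y - x⟫ + (μ / 2) * ‖y - x‖ ^ 2)
    (hlip : ∀ x y, ‖h' x - h' y‖ ≤ L * ‖x - y‖)
    (xb y : EuclideanSpace ℝ (Fin n)) (hne : xb ≠ y) (hlevel : h xb = h y) :
    (μ / 2) * ‖y - xb‖ ^ 2 ≤ ⟪h' y, y - xb⟫ ∧
    h' xb ≠ h' y ∧
    μ / (2 * L) ≤ ⟪h' y, y - xb⟫ / (‖h' xb - h' y‖ * ‖y - xb‖) := by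
  have hd : 0 < ‖y - xb‖ := norm_pos_iff.mpr (sub_ne_zero.mpr hne.symm)
  have slope : (μ / 2) * ‖y - xb‖ ^ 2 ≤ ⟪h' y, y - xb⟫ := by
    have key := hsc y xb
    rw [← neg_sub y xb, inner_neg_right, norm_neg] at key
    linarith
  have grad_ne : h' xb ≠ h' y := by
    intro heq
    have key := hsc xb y
    rw [heq] at key
    have : 0 < μ * ‖y - xb‖ ^ 2 := by positivity
    linarith
  have hg : 0 < ‖h' xb - h' y‖ := norm_pos_iff.mpr (sub_ne_zero.mpr grad_ne)
  have hL : 0 < L := hμ.trans_le hμL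
  refine ⟨slope, grad_ne, ?_⟩
  rw [le_div_iff₀ (mul_pos hg hd)]
  have hlip' : ‖h' xb - h' y‖ ≤ L * ‖y - xb‖ := norm_sub_rev y xb ▸ hlip xb y
  calc μ / (2 * L) * (‖h' xb - h' y‖ * ‖y - xb‖)
      ≤ μ / (2 * L) * ((L * ‖y - xb‖) * ‖y - xb‖) := by gcongr
    _ = (μ / 2) * ‖y - xb‖ ^ 2 := by field_simp
    _ ≤ ⟪h' y, y - xb⟫ := slope
end

section
/- Let m ≥ 1 and for each i = 1,…,m let Ω_i ⊆ ℝ^{n_i} be a nonempty closed convex set; let Ω = Ω_1 × ⋯ × Ω_m ⊆ ℝ^{n_1} × ⋯ × ℝ^{n_m} with the Euclidean (ℓ²) product norm. Let x ∈ Ω, g = (g_{(1)},…,g_{(m)}), τ_1,…,τ_m > 0, and for each i let u_i ∈ ℝ^{n_i} be a unit vector with ⟨g_{(i)}, u_i⟩ ≥ τ_i·dist(g_{(i)}, N_{Ω_i}(x_{(i)})). Define d by d_{(i)} = ⟨g_{(i)}, u_i⟩·u_i, and let τ* = min_i τ_i. Then ⟨g, d⟩ ≥ τ*·dist(g, N_Ω(x))·‖d‖.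 -/
open scoped RealInnerProductSpace

theorem zero_mem_normalCone {E : Type*} [NormedAddCommGroup E] [InnerProductSpace ℝ E]
    (Ω : Set E) (x : E) : (0 : E) ∈ normalCone Ω x := by
  intro y _
  simp

theorem isClosed_normalCone {E : Type*} [NormedAddCommGroup E] [InnerProductSpace ℝ E]
    (Ω : Set E) (x : E) : IsClosed (normalCone Ω x) := by
  simp only [normalCone, Set.ofPred_forall]
  exact isClosed_iInter fun y => isClosed_iInter fun _ =>
    isClosed_le (by fun_prop) continuous_const

theorem mem_normalCone_pi {ι : Type*} [Fintype ι] {E : ι → Type*}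
    [∀ i, NormedAddCommGroup (E i)] [∀ i, InnerProductSpace ℝ (E i)]
    (Ω : ∀ i, Set (E i)) (x p : PiLp 2 E) (hp : ∀ i, p i ∈ normalCone (Ω i) (x i)) :
    p ∈ normalCone {z : PiLp 2 E | ∀ i, z i ∈ Ω i} x := by
  intro y hy
  rw [PiLp.inner_apply]
  exact Finset.sum_nonpos fun i _ => hp i (y i) (hy i)

/-- The squared distance to the normal cone of a product is at most the sum of the squared
distances to the normal cones of the factors. -/
theorem infDist_normalCone_pi_sq_le {ι : Type*} [Fintype ι] {E : ι → Type*}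
    [∀ i, NormedAddCommGroup (E i)] [∀ i, InnerProductSpace ℝ (E i)] [∀ i, ProperSpace (E i)]
    (Ω : ∀ i, Set (E i)) (x g : PiLp 2 E) :
    Metric.infDist g (normalCone {z : PiLp 2 E | ∀ i, z i ∈ Ω i} x) ^ 2
      ≤ ∑ i, Metric.infDist (g i) (normalCone (Ω i) (x i)) ^ 2 := by
  choose p hp hpd using fun i => (isClosed_normalCone (Ω i) (x i)).exists_infDist_eq_dist
    ⟨0, zero_mem_normalCone _ _⟩ (g i)
  have hle : Metric.infDist g (normalCone {z : PiLp 2 E | ∀ i, z i ∈ Ω i} x)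
      ≤ dist g (WithLp.toLp 2 p) :=
    Metric.infDist_le_dist_of_mem (mem_normalCone_pi Ω x _ hp)
  calc _ ≤ dist g (WithLp.toLp 2 p) ^ 2 := pow_le_pow_left₀ Metric.infDist_nonneg hle 2
    _ = ∑ i, Metric.infDist (g i) (normalCone (Ω i) (x i)) ^ 2 := by
      rw [dist_eq_norm, PiLp.norm_sq_eq_of_L2]
      exact Finset.sum_congr rfl fun i _ => by rw [hpd i, dist_eq_norm]; rfl

/-- Proposition 6.7, item 1: on a product `Ω = Ω₁ × ⋯ × Ω_m` with the `ℓ²`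
product norm, if in each block `uᵢ` is a unit vector with
`⟨g_{(i)}, uᵢ⟩ ≥ τᵢ·dist(g_{(i)}, N_{Ωᵢ}(x_{(i)}))`, and `d_{(i)} = ⟨g_{(i)}, uᵢ⟩·uᵢ`, then with
`τ* = minᵢ τᵢ`, `⟨g, d⟩ ≥ τ*·dist(g, N_Ω(x))·‖d‖`. -/
theorem product_domain_slope_bound
    {m : ℕ} (hm : 0 < m) {dim : Fin m → ℕ}
    (Ω : ∀ i : Fin m, Set (EuclideanSpace ℝ (Fin (dim i))))
    (hne : ∀ i, (Ω i).Nonempty) (hcl : ∀ i, IsClosed (Ω i)) (hconv : ∀ i, Convex ℝ (Ω i))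
    (x g : PiLp 2 (fun i : Fin m => EuclideanSpace ℝ (Fin (dim i))))
    (hx : ∀ i, x i ∈ Ω i)
    (τ : Fin m → ℝ) (hτ : ∀ i, 0 < τ i)
    (u : ∀ i : Fin m, EuclideanSpace ℝ (Fin (dim i)))
    (hu : ∀ i, ‖u i‖ = 1)
    (hslope : ∀ i, τ i * Metric.infDist (g i) (normalCone (Ω i) (x i)) ≤ ⟪g i, u i⟫)
    (d : PiLp 2 (fun i : Fin m => EuclideanSpace ℝ (Fin (dim i))))
    (hd : ∀ i, d i = ⟪g i, u i⟫ • u i)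
    (τstar : ℝ) (hτstar : IsLeast (Set.range τ) τstar) :
    τstar * Metric.infDist g
        (normalCone {z : PiLp 2 (fun i : Fin m => EuclideanSpace ℝ (Fin (dim i))) |
          ∀ i, z i ∈ Ω i} x) * ‖d‖
      ≤ ⟪g, d⟫ := by
  obtain ⟨⟨j, hj⟩, hmin⟩ := hτstar
  have hpos : 0 < τstar := hj ▸ hτ j
  have hinner : ⟪g, d⟫ = ‖d‖ ^ 2 := by
    rw [PiLp.inner_apply, PiLp.norm_sq_eq_of_L2]
    refine Finset.sum_congr rfl fun i _ => ?_
    rw [hd i, real_inner_smul_right, norm_smul, hu i, mul_one, Real.norm_eq_abs, sq_abs, sq]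
  have hsq : (τstar * Metric.infDist g
      (normalCone {z : PiLp 2 (fun i : Fin m => EuclideanSpace ℝ (Fin (dim i))) |
        ∀ i, z i ∈ Ω i} x)) ^ 2 ≤ ‖d‖ ^ 2 := by
    rw [mul_pow]
    refine (mul_le_mul_of_nonneg_left (infDist_normalCone_pi_sq_le Ω x g)
      (sq_nonneg τstar)).trans ?_
    rw [Finset.mul_sum, PiLp.norm_sq_eq_of_L2]
    refine Finset.sum_le_sum fun i _ => ?_
    rw [hd i, norm_smul, hu i, mul_one, Real.norm_eq_abs, sq_abs, ← mul_pow]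
    exact pow_le_pow_left₀ (mul_nonneg hpos.le Metric.infDist_nonneg)
      ((mul_le_mul_of_nonneg_right (hmin ⟨i, rfl⟩) Metric.infDist_nonneg).trans (hslope i)) 2
  rw [hinner, sq]
  exact mul_le_mul_of_nonneg_right (abs_le_of_sq_le_sq' hsq (norm_nonneg d)).2 (norm_nonneg d)
end

section
/- Define γ(r) = 1 − √(1 − r²) for r ∈ [0,1]. Then for every s ∈ (0,1], setting t = √(1 − s²), one has (s − t·γ(s)) / (s·√(s² + γ(s)²)) ≥ 1/2. -/
/-- The half-angle form of the inequality, with `x = sin a` and `c = cos a` for `a ∈ [0, π/4]`. -/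
theorem sin_mul_cos_two_mul_le_cos_mul_one_sub_sin {x c : ℝ} (hx : 0 ≤ x) (hxc : x ≤ c)
    (h : x ^ 2 + c ^ 2 = 1) : x * (1 - 2 * x ^ 2) ≤ c * (1 - x) := by
  have hx1 : x ≤ 1 := by nlinarith
  rcases le_total (1 / 2) x with hx2 | hx2
  · nlinarith [mul_le_mul_of_nonneg_right hxc (sub_nonneg.2 hx1),
      mul_nonneg (mul_nonneg hx hx) (sub_nonneg.2 hx2)]
  · have hc : 4 / 5 ≤ c := by nlinarith
    nlinarith [mul_le_mul_of_nonneg_right hc (sub_nonneg.2 hx1),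
      mul_nonneg hx (sq_nonneg (x - 2 / 5)), sq_nonneg (x - 2 / 5)]

/-- with `γ(r) = 1 − √(1 − r²)`, for every `s ∈ (0,1]` and `t = √(1 − s²)`,
`(s − t·γ(s)) / (s·√(s² + γ(s)²)) ≥ 1/2`. -/
theorem orthographic_retraction_slope_inequality :
    ∀ s : ℝ, 0 < s → s ≤ 1 →
      (1 / 2 : ℝ)
        ≤ (s - Real.sqrt (1 - s ^ 2) * (1 - Real.sqrt (1 - s ^ 2)))
            / (s * Real.sqrt (s ^ 2 + (1 - Real.sqrt (1 - s ^ 2)) ^ 2)) := by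
  intro s hs hs1
  have ht0 := Real.sqrt_nonneg (1 - s ^ 2)
  have ht2 : √(1 - s ^ 2) ^ 2 = 1 - s ^ 2 := Real.sq_sqrt (by nlinarith)
  set t := √(1 - s ^ 2)
  have ht1 : t < 1 := by nlinarith
  have hx : 0 < √((1 - t) / 2) := Real.sqrt_pos.2 (by linarith)
  have hx2 : √((1 - t) / 2) ^ 2 = (1 - t) / 2 := Real.sq_sqrt (by linarith)
  have hc2 : √((1 + t) / 2) ^ 2 = (1 + t) / 2 := Real.sq_sqrt (by linarith)
  have hxc : √((1 - t) / 2) ≤ √((1 + t) / 2) := Real.sqrt_le_sqrt (by linarith)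
  set x := √((1 - t) / 2)
  set c := √((1 + t) / 2)
  have hsx : s = 2 * x * c := by
    rw [← sq_eq_sq₀ hs.le (by nlinarith), mul_pow, mul_pow, hx2, hc2]
    linarith
  have htx : t = 1 - 2 * x ^ 2 := by linarith
  have hr : √(s ^ 2 + (1 - t) ^ 2) = 2 * x := by
    rw [Real.sqrt_eq_iff_eq_sq (by positivity) (by positivity), mul_pow, hx2]
    linarith
  have key := sin_mul_cos_two_mul_le_cos_mul_one_sub_sin hx.le hxc (by linarith)
  rw [hr, le_div_iff₀ (by positivity), hsx, htx]
  linarith [mul_le_mul_of_nonneg_left key hx.le]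
end

section
/- Let L > 0, K > 0, f̃ ∈ ℝ, and let {F_k}_{k≥0}, {G_k}_{k≥1}, {s_k}_{k≥0}, {p_k}_{k≥0} be real sequences with s_k ≥ 0, p_k ≥ 0, satisfying for every k: F_{k+1} ≤ G_{k+1} ≤ F_k − (L/2)·s_k², p_k ≤ s_k/K, and F_k ≥ f̃. Then for every k ≥ 0: min_{0 ≤ i ≤ k} p_i ≤ min_{0 ≤ i ≤ k} s_i/K ≤ √( 2(F_0 − f̃) / (K²·L·(k+1)) ). -/
/-- Telescoping a sufficient decrease `F (k + 1) ≤ F k - a k`. -/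
theorem sum_range_le_sub_of_decrease {F a : ℕ → ℝ} (h : ∀ k, F (k + 1) ≤ F k - a k) (n : ℕ) :
    ∑ i ∈ Finset.range n, a i ≤ F 0 - F n := by
  rw [← Finset.sum_range_sub' F n]
  exact Finset.sum_le_sum fun i _ => by linarith [h i]

/-- quantitative part of Corollary 4.3: if for all `k`,
`F_{k+1} ≤ G_{k+1} ≤ F_k − (L/2)s_k²`, `p_k ≤ s_k/K` and `F_k ≥ f̃`, then for every `k`,
`min_{0≤i≤k} p_i ≤ min_{0≤i≤k} s_i/K ≤ √(2(F₀ − f̃)/(K²·L·(k+1)))`. -/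
theorem min_projected_gradient_rate
    (L K ftil : ℝ) (hL : 0 < L) (hK : 0 < K)
    (F G s p : ℕ → ℝ)
    (hs : ∀ k, 0 ≤ s k) (hp : ∀ k, 0 ≤ p k)
    (h1 : ∀ k, F (k + 1) ≤ G (k + 1))
    (h2 : ∀ k, G (k + 1) ≤ F k - (L / 2) * s k ^ 2)
    (h3 : ∀ k, p k ≤ s k / K)
    (h4 : ∀ k, ftil ≤ F k) :
    ∀ k : ℕ,
      (Finset.range (k + 1)).inf' (Finset.nonempty_range_iff.mpr (Nat.succ_ne_zero k)) p
        ≤ (Finset.range (k + 1)).inf' (Finset.nonempty_range_iff.mpr (Nat.succ_ne_zero k))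
            (fun i => s i / K) ∧
      (Finset.range (k + 1)).inf' (Finset.nonempty_range_iff.mpr (Nat.succ_ne_zero k))
          (fun i => s i / K)
        ≤ Real.sqrt (2 * (F 0 - ftil) / (K ^ 2 * L * (k + 1))) := by
  intro k
  refine ⟨Finset.inf'_mono_fun fun i _ => h3 i, ?_⟩
  set m := (Finset.range (k + 1)).inf' (Finset.nonempty_range_iff.mpr (Nat.succ_ne_zero k))
    (fun i => s i / K)
  have hm0 : 0 ≤ m := Finset.le_inf' _ _ fun i _ => div_nonneg (hs i) hK.le
  have hms : ∀ i ∈ Finset.range (k + 1), L / 2 * (m * K) ^ 2 ≤ L / 2 * s i ^ 2 := by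
    intro i hi
    have hle : m * K ≤ s i := (le_div_iff₀ hK).mp (Finset.inf'_le (fun i => s i / K) hi)
    gcongr
  have hcard := Finset.card_nsmul_le_sum _ _ _ hms
  have htel := sum_range_le_sub_of_decrease (fun k => (h1 k).trans (h2 k)) (k + 1)
  rw [Finset.card_range, nsmul_eq_mul] at hcard
  push_cast at hcard
  apply Real.le_sqrt_of_sq_le
  rw [le_div_iff₀ (by positivity)]
  linarith [h4 (k + 1)]
end
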